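/- If additionally 0 < αL ≤ 1/10, then the FO-MAML bias vector r(w) = ∑_{i∈I} p_i ((I − α∇²f_i(w))⁻¹ − I) ∇F_i(w) satisfies ‖r(w)‖ ≤ 0.22 ‖∇F(w)‖ + 2αLσ for every w ∈ ℝ^d. -/

import Mathlib

open scoped BigOperators

section HessianOfSmoothFunction

variable {E : Type*} [NormedAddCommGroup E] [InnerProductSpace ℝ E] [CompleteSpace E]

theorem ContDiff.differentiable_gradient {f : E → ℝ} (hf : ContDiff ℝ 2 f) :
    Differentiable ℝ (gradient f) := by
  have h : Differentiable ℝ (fderiv ℝ f) :=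
    (hf.fderiv_right (m := 1) (by norm_num)).differentiable (by norm_num)
  exact (InnerProductSpace.toDual ℝ E).symm.differentiable.comp h

theorem inner_fderiv_gradient {f : E → ℝ} (hf : ContDiff ℝ 2 f) (w u v : E) :
    inner ℝ (fderiv ℝ (gradient f) w u) v = fderiv ℝ (fderiv ℝ f) w u v := by
  have hinner : (fun x => inner ℝ (gradient f x) v) = fun x => fderiv ℝ f x v := by
    funext x
    simp [gradient]
  have hleft := (hf.differentiable_gradient w).hasFDerivAt.inner ℝ (hasFDerivAt_const v w)
  have hright := (((hf.fderiv_right (m := 1) (by norm_num)).differentiable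
    (by norm_num) w).hasFDerivAt).clm_apply (hasFDerivAt_const v w)
  rw [hinner] at hleft
  simpa using DFunLike.congr_fun (hleft.unique hright) u

theorem inner_fderiv_gradient_comm {f : E → ℝ} (hf : ContDiff ℝ 2 f) (w u v : E) :
    inner ℝ (fderiv ℝ (gradient f) w u) v = inner ℝ u (fderiv ℝ (gradient f) w v) := by
  rw [real_inner_comm _ u, inner_fderiv_gradient hf, inner_fderiv_gradient hf]
  exact (hf.contDiffAt.isSymmSndFDerivAt (by simp)).eq u v

theorem norm_fderiv_gradient_le {f : E → ℝ} {L : ℝ} (hL : 0 ≤ L)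
    (hlip : ∀ w u, ‖gradient f w - gradient f u‖ ≤ L * ‖w - u‖) (w : E) :
    ‖fderiv ℝ (gradient f) w‖ ≤ L :=
  norm_fderiv_le_of_lip' ℝ hL (Filter.Eventually.of_forall fun x => hlip x w)

/-- The gradient of `f` after one gradient descent step. -/
theorem hasGradientAt_comp_gradient_step {f : E → ℝ} (hf : ContDiff ℝ 2 f) (α : ℝ) (w : E) :
    HasGradientAt (fun v => f (v - α • gradient f v))
      ((1 - α • fderiv ℝ (gradient f) w) (gradient f (w - α • gradient f w))) w := by
  rw [hasGradientAt_iff_hasFDerivAt]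
  have hstep : HasFDerivAt (fun v => v - α • gradient f v)
      (ContinuousLinearMap.id ℝ E - α • fderiv ℝ (gradient f) w) w :=
    (hasFDerivAt_id w).sub ((hf.differentiable_gradient w).hasFDerivAt.const_smul α)
  have hf' : HasFDerivAt f (InnerProductSpace.toDual ℝ E (gradient f (w - α • gradient f w)))
      (w - α • gradient f w) :=
    (hf.differentiable (by norm_num) _).hasGradientAt.hasFDerivAt
  refine (hf'.comp w hstep).congr_fderiv ?_
  ext v
  simp [inner_fderiv_gradient_comm hf]

theorem hasGradientAt_sum_mul {ι : Type*} [Fintype ι] {p : ι → ℝ} {f : ι → E → ℝ}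
    {g : ι → E} {w : E} (h : ∀ i, HasGradientAt (f i) (g i) w) :
    HasGradientAt (fun v => ∑ i, p i * f i v) (∑ i, p i • g i) w := by
  rw [hasGradientAt_iff_hasFDerivAt]
  have := HasFDerivAt.fun_sum (u := Finset.univ)
    fun i _ => (h i).hasFDerivAt.const_mul (p i)
  refine this.congr_fderiv ?_
  simp

end HessianOfSmoothFunction

theorem Finset.sum_mul_le_of_sum_mul_sq_le {ι : Type*} [Fintype ι] {p a : ι → ℝ} {σ : ℝ}
    (hp : ∀ i, 0 ≤ p i) (hpsum : ∑ i, p i = 1) (hσ : 0 ≤ σ)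
    (h : ∑ i, p i * a i ^ 2 ≤ σ ^ 2) : ∑ i, p i * a i ≤ σ := by
  have hmean := (even_two.convexOn_pow (𝕜 := ℝ)).map_sum_le (t := Finset.univ) (w := p) (p := a)
    (fun i _ => hp i) hpsum (fun i _ => Set.mem_univ _)
  exact (le_abs_self _).trans (abs_le_of_sq_le_sq (hmean.trans h) hσ)

theorem norm_sum_smul_le {E ι : Type*} [Fintype ι] [NormedAddCommGroup E] [NormedSpace ℝ E]
    {p b : ι → ℝ} {x : ι → E} (hp : ∀ i, 0 ≤ p i) (h : ∀ i, ‖x i‖ ≤ b i) :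
    ‖∑ i, p i • x i‖ ≤ ∑ i, p i * b i := by
  refine (norm_sum_le _ _).trans (Finset.sum_le_sum fun i _ => ?_)
  rw [norm_smul, Real.norm_of_nonneg (hp i)]
  exact mul_le_mul_of_nonneg_left (h i) (hp i)

/-- **Bound on the FO-MAML bias vector** (inequalities
`proof_001_007`–`thm_FMAML_ineq1`): if `0 < αL ≤ 1/10`, the bias
`r(w) = ∑ᵢ pᵢ ((I − α∇²fᵢ(w))⁻¹ − I)∇Fᵢ(w)` satisfies
`‖r(w)‖ ≤ 0.22‖∇F(w)‖ + 2αLσ`. -/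
theorem fomaml_bias_bound
    {d : ℕ} {ι : Type*} [Fintype ι]
    (p : ι → ℝ) (hp : ∀ i, 0 ≤ p i) (hpsum : ∑ i, p i = 1)
    (f : ι → EuclideanSpace ℝ (Fin d) → ℝ)
    (L α σ : ℝ) (hL : 0 < L) (hα0 : 0 < α) (hαL : α * L ≤ 1 / 10) (hσ : 0 ≤ σ)
    (hf : ∀ i, ContDiff ℝ 2 (f i))
    (hgrad : ∀ i w u, ‖gradient (f i) w - gradient (f i) u‖ ≤ L * ‖w - u‖)
    (F fbar : EuclideanSpace ℝ (Fin d) → ℝ)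
    (hF : ∀ w, F w = ∑ i, p i * f i (w - α • gradient (f i) w))
    (hfbar : ∀ w, fbar w = ∑ i, p i * f i w)
    (hvar : ∀ w, ∑ i, p i * ‖gradient (f i) w - gradient fbar w‖ ^ 2 ≤ σ ^ 2)
    (r : EuclideanSpace ℝ (Fin d) → EuclideanSpace ℝ (Fin d))
    (hr : ∀ w, r w = ∑ i, p i •
      ((Ring.inverse (1 - α • fderiv ℝ (gradient (f i)) w) - 1)
        (gradient (fun v => f i (v - α • gradient (f i) v)) w))) :
    ∀ w, ‖r w‖ ≤ 0.22 * ‖gradient F w‖ + 2 * α * L * σ := by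
  intro w
  set x := α * L with hx
  have hx0 : 0 < x := mul_pos hα0 hL
  set H := fun i => α • fderiv ℝ (gradient (f i)) w
  set g := fun i => gradient (f i) w
  set h := fun i => gradient (f i) (w - α • g i)
  have hH : ∀ i, ‖H i‖ ≤ x := fun i => by
    simp only [H, norm_smul, Real.norm_of_nonneg hα0.le, hx]
    exact mul_le_mul_of_nonneg_left (norm_fderiv_gradient_le hL.le (hgrad i) w) hα0.le
  have hhg : ∀ i, ‖h i - g i‖ ≤ x * ‖g i‖ := fun i => by
    refine (hgrad i _ _).trans_eq ?_
    rw [sub_sub_cancel_left, norm_neg, norm_smul, Real.norm_of_nonneg hα0.le]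
    ring
  have hh : ∀ i, ‖h i‖ ≤ (1 + x) * ‖g i‖ := fun i => by
    linarith [norm_le_insert' (h i) (g i), hhg i]
  have hHh : ∀ i, ‖H i (h i)‖ ≤ x * (1 + x) * ‖g i‖ := fun i => by
    rw [mul_assoc]
    exact (H i).le_of_opNorm_le_of_le (hH i) (hh i)
  have hFi : ∀ i, HasGradientAt (fun v => f i (v - α • gradient (f i) v)) ((1 - H i) (h i)) w :=
    fun i => hasGradientAt_comp_gradient_step (hf i) α w
  have hgradF : gradient F w = ∑ i, p i • (1 - H i) (h i) := by
    rw [funext hF]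
    exact (hasGradientAt_sum_mul hFi).gradient
  have hgradf : gradient fbar w = ∑ i, p i • g i := by
    rw [funext hfbar]
    exact (hasGradientAt_sum_mul fun i =>
      ((hf i).differentiable (by norm_num) w).hasGradientAt).gradient
  have hrw : r w = ∑ i, p i • H i (h i) := by
    rw [hr]
    refine Finset.sum_congr rfl fun i _ => ?_
    have hunit : IsUnit (1 - H i) :=
      isUnit_one_sub_of_norm_lt_one ((hH i).trans_lt (by linarith))
    have hinv : Ring.inverse (1 - H i) ((1 - H i) (h i)) = h i :=
      DFunLike.congr_fun (Ring.inverse_mul_cancel _ hunit) (h i)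
    rw [(hFi i).gradient, sub_apply, hinv]
    simp
  have hsum : ∑ i, p i * ‖g i‖ ≤ ‖gradient fbar w‖ + σ := by
    have hdev := Finset.sum_mul_le_of_sum_mul_sq_le hp hpsum hσ (hvar w)
    calc ∑ i, p i * ‖g i‖
        ≤ ∑ i, p i * (‖gradient fbar w‖ + ‖g i - gradient fbar w‖) :=
          Finset.sum_le_sum fun i _ =>
            mul_le_mul_of_nonneg_left (norm_le_insert' _ _) (hp i)
      _ = ‖gradient fbar w‖ + ∑ i, p i * ‖g i - gradient fbar w‖ := by
          simp only [mul_add, Finset.sum_add_distrib, ← Finset.sum_mul, hpsum, one_mul]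
      _ ≤ ‖gradient fbar w‖ + σ := by gcongr
  have hsum0 : 0 ≤ ∑ i, p i * ‖g i‖ :=
    Finset.sum_nonneg fun i _ => mul_nonneg (hp i) (norm_nonneg _)
  have hrS : ‖r w‖ ≤ x * (1 + x) * ∑ i, p i * ‖g i‖ := by
    rw [hrw, Finset.mul_sum]
    refine (norm_sum_smul_le hp hHh).trans_eq (Finset.sum_congr rfl fun i _ => by ring)
  have hdiff : ‖gradient F w - gradient fbar w‖ ≤ (2 * x + x ^ 2) * ∑ i, p i * ‖g i‖ := by
    have heq : gradient F w - gradient fbar w = ∑ i, p i • ((h i - g i) - H i (h i)) := by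
      rw [hgradF, hgradf, ← Finset.sum_sub_distrib]
      refine Finset.sum_congr rfl fun i _ => ?_
      rw [← smul_sub, sub_apply, one_apply_eq_self,
        sub_right_comm]
    rw [heq, Finset.mul_sum]
    refine (norm_sum_smul_le hp fun i => (norm_sub_le _ _).trans
      (add_le_add (hhg i) (hHh i))).trans_eq (Finset.sum_congr rfl fun i _ => by ring)
  have htri : ‖gradient fbar w‖ ≤ ‖gradient F w‖ + ‖gradient F w - gradient fbar w‖ :=
    norm_le_norm_add_norm_sub _ _
  set S := ∑ i, p i * ‖g i‖
  set N := ‖gradient F w‖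
  have hN : 0 ≤ N := norm_nonneg _
  have hS : 0.79 * S ≤ N + σ := by
    have : (2 * x + x ^ 2) * S ≤ 0.21 * S :=
      mul_le_mul_of_nonneg_right (by nlinarith) hsum0
    linarith
  have hS' : x * (1 + x) * S ≤ x * (1.4 * (N + σ)) := by
    rw [mul_assoc]
    refine mul_le_mul_of_nonneg_left ?_ hx0.le
    have : (1 + x) * S ≤ 1.1 * S := mul_le_mul_of_nonneg_right (by linarith) hsum0
    linarith
  have hxN : x * N ≤ 1 / 10 * N := mul_le_mul_of_nonneg_right hαL hN
  have hxσ : 0 ≤ x * σ := mul_nonneg hx0.le hσ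
  have : 2 * α * L * σ = 2 * (x * σ) := by rw [hx]; ring
  linarith
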